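/- arXiv:0808.2851 — 2 statements merged into one kernel-verified Lean document; each statement's English description precedes it below -/
import Mathlib

section
/- For every ν ≥ 1, every 1 ≤ p ≤ ∞, every 0 ≤ m < 4^ν and all complex scalars α_0, …, α_{4^ν−1}, one has ‖Σ_{j=0}^{m} α_j e^{(ν)}_j‖_{p,♭} ≤ 2 · ‖Σ_{j=0}^{4^ν−1} α_j e^{(ν)}_j‖_{p,♭}. (Lemma: the matrix units in shell enumeration form a basic sequence with constant 2 for the right norms.) -/
open Finset
open scoped ENNReal ComplexOrder Kronecker Matrix

noncomputable section

/-- Kronecker product of square complex matrices, realized on `Fin (m * n)`. -/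
def kron {m n : ℕ} (x : Matrix (Fin m) (Fin m) ℂ) (y : Matrix (Fin n) (Fin n) ℂ) :
    Matrix (Fin (m * n)) (Fin (m * n)) ℂ :=
  Matrix.reindex finProdFinEquiv finProdFinEquiv (x ⊗ₖ y)

/-- The matrix `A₁ = diag(α, 1 - α)`. -/
def A1 (α : ℝ) : Matrix (Fin 2) (Fin 2) ℂ :=
  Matrix.diagonal ![(α : ℂ), ((1 - α : ℝ) : ℂ)]

/-- The matrix `A₁^t = diag(α^t, (1 - α)^t)` (entrywise real power on the diagonal). -/
def A1t (α t : ℝ) : Matrix (Fin 2) (Fin 2) ℂ :=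
  Matrix.diagonal ![((α ^ t : ℝ) : ℂ), (((1 - α) ^ t : ℝ) : ℂ)]

/-- `Amat α ν = A_ν`, the ν-fold Kronecker power of `diag(α, 1-α)`. -/
def Amat (α : ℝ) : (ν : ℕ) → Matrix (Fin (2 ^ ν)) (Fin (2 ^ ν)) ℂ
  | 0 => 1
  | ν + 1 => kron (Amat α ν) (A1 α)

/-- `Amatt α t ν = A_ν^t`, the ν-fold Kronecker power of `diag(α^t, (1-α)^t)`. -/
def Amatt (α t : ℝ) : (ν : ℕ) → Matrix (Fin (2 ^ ν)) (Fin (2 ^ ν)) ℂ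
  | 0 => 1
  | ν + 1 => kron (Amatt α t ν) (A1t α t)

/-- The state `ρ_ν(x) = Tr (x A_ν)` on `N_ν = M_{2^ν}(ℂ)`. -/
def rho (α : ℝ) (ν : ℕ) (x : Matrix (Fin (2 ^ ν)) (Fin (2 ^ ν)) ℂ) : ℂ :=
  (x * Amat α ν).trace

/-- The state `ρ_1(x) = Tr (x A_1)` on `M_2(ℂ)`. -/
def rho1 (α : ℝ) (x : Matrix (Fin 2) (Fin 2) ℂ) : ℂ :=
  (x * A1 α).trace

/-- The Schatten `p`-norm `‖x‖_{C_p} = (Tr ((x^* x)^{p/2}))^{1/p}`, `1 ≤ p < ∞`,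
computed through the eigenvalues of the positive semidefinite matrix `x^* x`. -/
def schatten {N : ℕ} (p : ℝ) (x : Matrix (Fin N) (Fin N) ℂ) : ℝ :=
  (∑ i, ((Matrix.posSemidef_conjTranspose_mul_self x).isHermitian.eigenvalues i) ^ (p / 2)) ^
    (1 / p)

/-- The operator norm `‖x‖ = ‖x‖_{C_∞}` of a complex matrix (acting on ℓ²). -/
def opNorm {N : ℕ} (x : Matrix (Fin N) (Fin N) ℂ) : ℝ :=
  ‖Matrix.toEuclideanCLM (𝕜 := ℂ) x‖

/-- The left predual norm `‖x‖_♯ = ‖x A_ν‖_{C_1}` on `N_ν`. -/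
def sharpNorm (α : ℝ) {ν : ℕ} (x : Matrix (Fin (2 ^ ν)) (Fin (2 ^ ν)) ℂ) : ℝ :=
  schatten 1 (x * Amat α ν)

/-- The right predual norm `‖x‖_♭ = ‖A_ν x‖_{C_1}` on `N_ν`. -/
def flatNorm (α : ℝ) {ν : ℕ} (x : Matrix (Fin (2 ^ ν)) (Fin (2 ^ ν)) ℂ) : ℝ :=
  schatten 1 (Amat α ν * x)

/-- The left predual norm `‖x‖_♯ = ‖x A_1‖_{C_1}` on `M_2(ℂ)`. -/
def sharp2 (α : ℝ) (x : Matrix (Fin 2) (Fin 2) ℂ) : ℝ :=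
  schatten 1 (x * A1 α)

/-- The right predual norm `‖x‖_♭ = ‖A_1 x‖_{C_1}` on `M_2(ℂ)`. -/
def flat2 (α : ℝ) (x : Matrix (Fin 2) (Fin 2) ℂ) : ℝ :=
  schatten 1 (A1 α * x)

/-- The left norm `‖x‖_{p,♯} = ‖x A_ν^{1/p}‖_{C_p}` on `N_ν`, `1 ≤ p ≤ ∞`
(for `p = ∞` it is the operator norm). -/
def lpSharp (α : ℝ) (p : ℝ≥0∞) {ν : ℕ} (x : Matrix (Fin (2 ^ ν)) (Fin (2 ^ ν)) ℂ) : ℝ :=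
  if p = ∞ then opNorm x else schatten p.toReal (x * Amatt α (1 / p.toReal) ν)

/-- The right norm `‖x‖_{p,♭} = ‖A_ν^{1/p} x‖_{C_p}` on `N_ν`, `1 ≤ p ≤ ∞`. -/
def lpFlat (α : ℝ) (p : ℝ≥0∞) {ν : ℕ} (x : Matrix (Fin (2 ^ ν)) (Fin (2 ^ ν)) ℂ) : ℝ :=
  if p = ∞ then opNorm x else schatten p.toReal (Amatt α (1 / p.toReal) ν * x)

/-- The left norm `‖x‖_{p,♯} = ‖x A_1^{1/p}‖_{C_p}` on `M_2(ℂ)`. -/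
def lp2Sharp (α : ℝ) (p : ℝ≥0∞) (x : Matrix (Fin 2) (Fin 2) ℂ) : ℝ :=
  if p = ∞ then opNorm x else schatten p.toReal (x * A1t α (1 / p.toReal))

/-- `shellNum r c` is `s(r+1, c+1) - 1`, the zero-based shell enumeration index of the
matrix unit `E_{r c}` (zero-based indices `r`, `c`): `s(r,c) = (c-1)² + r` if `r ≤ c`
and `s(r,c) = r² - c + 1` if `r > c` (one-based). -/
def shellNum (r c : ℕ) : ℕ :=
  if r ≤ c then c * c + r else r * r + 2 * r - c

/-- `eUnit N m` is the `m`-th matrix unit `e_m` of `M_N(ℂ)` in the shell enumeration: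
`e_{s(r,c) - 1} = E_{r c}`. -/
def eUnit (N m : ℕ) : Matrix (Fin N) (Fin N) ℂ :=
  Matrix.of fun r c => if shellNum (r : ℕ) (c : ℕ) = m then 1 else 0

/-- The left Haar system `h^{(ν)}_j` in `N_ν` built from `r_0, r_1, r_2, r_3 ∈ M_2(ℂ)`:
`h^{(1)}_j = r_j`, and for `j = 4^ν q + k` (`0 ≤ q ≤ 3`, `0 ≤ k < 4^ν`),
`h^{(ν+1)}_j = h^{(ν)}_k ⊗ r_0` if `q = 0` and `h^{(ν+1)}_j = e^{(ν)}_k ⊗ r_q` if `q ≠ 0`. -/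
def haar (r : ℕ → Matrix (Fin 2) (Fin 2) ℂ) :
    (ν : ℕ) → ℕ → Matrix (Fin (2 ^ ν)) (Fin (2 ^ ν)) ℂ
  | 0, _ => 1
  | 1, j => r (j % 4)
  | ν + 2, j =>
      if j / 4 ^ (ν + 1) = 0 then kron (haar r (ν + 1) j) (r 0)
      else kron (eUnit (2 ^ (ν + 1)) (j % 4 ^ (ν + 1))) (r (j / 4 ^ (ν + 1) % 4))


/-! ### Helper lemmas -/

/-- A coordinate projection. -/
def coordProj {N : ℕ} (P : ℕ → Prop) [DecidablePred P] : Matrix (Fin N) (Fin N) ℂ :=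
  Matrix.diagonal fun i => if P (i : ℕ) then 1 else 0

lemma shell_decomp (m : ℕ) : ∃ R C R' C' : ℕ → Prop, ∀ r c : ℕ,
    (shellNum r c ≤ m ↔ (R r ∧ C c) ∨ (R' r ∧ C' c)) ∧ ¬ ((R r ∧ C c) ∧ (R' r ∧ C' c)) := by
  obtain ⟨k, i, hi, rfl⟩ : ∃ k i, i ≤ 2 * k ∧ m = k * k + i := by
    refine ⟨Nat.sqrt m, m - Nat.sqrt m * Nat.sqrt m, ?_, ?_⟩
    · have := Nat.sqrt_le_add m
      omega
    · have := Nat.sqrt_le m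
      omega
  have big : ∀ t, k < t → k * k + 2 * k + 1 ≤ t * t := fun t ht => by nlinarith
  have small : ∀ t, t < k → t * t + 2 * t + 1 ≤ k * k := fun t ht => by nlinarith
  by_cases hik : i ≤ k
  · refine ⟨fun r => r < k, fun c => c < k, fun r => r ≤ i, fun c => c = k, fun r c => ?_⟩
    refine ⟨?_, by omega⟩
    unfold shellNum
    split_ifs with h
    · rcases lt_trichotomy c k with hc | rfl | hc
      · have := small c hc; omega
      · omega
      · have := big c hc; omega
    · rcases lt_trichotomy r k with hc | rfl | hc
      · have := small r hc; omega
      · omega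
      · have := big r hc; omega
  · refine ⟨fun r => r < k, fun c => c ≤ k, fun r => r = k, fun c => c ≤ k ∧ 2 * k ≤ c + i,
      fun r c => ?_⟩
    refine ⟨?_, by omega⟩
    unfold shellNum
    split_ifs with h
    · rcases lt_trichotomy c k with hc | rfl | hc
      · have := small c hc; omega
      · omega
      · have := big c hc; omega
    · rcases lt_trichotomy r k with hc | rfl | hc
      · have := small r hc; omega
      · omega
      · have := big r hc; omega

lemma shellNum_lt {N r c : ℕ} (hr : r < N) (hc : c < N) : shellNum r c < N * N := by
  unfold shellNum
  split_ifs with h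
  · nlinarith
  · have : r * r + 2 * r + 1 ≤ N * N := by nlinarith
    omega

lemma sum_eUnit_apply (N n : ℕ) (a : ℕ → ℂ) (r c : Fin N) :
    (∑ j ∈ Finset.range n, a j • eUnit N j) r c =
      if shellNum r c < n then a (shellNum r c) else 0 := by
  simp [Matrix.sum_apply, eUnit]

lemma Amatt_diag (α t : ℝ) (ν : ℕ) : ∃ d, Amatt α t ν = Matrix.diagonal d := by
  induction ν with
  | zero => exact ⟨fun _ => 1, by simp [Amatt]⟩
  | succ n ih =>
    obtain ⟨d, hd⟩ := ih
    rw [Amatt, hd, kron, A1t, Matrix.diagonal_kronecker_diagonal]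
    exact ⟨_, by rw [Matrix.reindex_apply, Matrix.submatrix_diagonal_equiv]; rfl⟩

lemma coordProj_norm_le {N : ℕ} (P : ℕ → Prop) [DecidablePred P] (x : EuclideanSpace ℂ (Fin N)) :
    ‖Matrix.toEuclideanCLM (𝕜 := ℂ) (coordProj (N := N) P) x‖ ≤ ‖x‖ := by
  rw [EuclideanSpace.norm_eq, EuclideanSpace.norm_eq]
  apply Real.sqrt_le_sqrt
  apply Finset.sum_le_sum
  intro i _
  rw [Matrix.ofLp_toEuclideanCLM, coordProj, Matrix.mulVec_diagonal]
  split_ifs <;> simp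

lemma inner_conj {N : ℕ} (M : Matrix (Fin N) (Fin N) ℂ) (x y : EuclideanSpace ℂ (Fin N)) :
    inner ℂ (Matrix.toEuclideanCLM (𝕜 := ℂ) M x) y =
      inner ℂ x (Matrix.toEuclideanCLM (𝕜 := ℂ) Mᴴ y) := by
  have : Matrix.toEuclideanCLM (𝕜 := ℂ) Mᴴ =
      ContinuousLinearMap.adjoint (Matrix.toEuclideanCLM (𝕜 := ℂ) M) := by
    rw [← ContinuousLinearMap.star_eq_adjoint, ← map_star, Matrix.star_eq_conjTranspose]
  rw [this, ContinuousLinearMap.adjoint_inner_right]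

lemma coordProj_herm {N : ℕ} (P : ℕ → Prop) [DecidablePred P] :
    (coordProj (N := N) P)ᴴ = coordProj P := by
  rw [coordProj, Matrix.diagonal_conjTranspose]
  congr 1
  ext i
  simp only [Pi.star_apply]
  split_ifs <;> simp

lemma bessel {N : ℕ} {E : Type*} [NormedAddCommGroup E] [InnerProductSpace ℂ E]
    (a : Fin N → E) (h0 : ∀ i j, i ≠ j → inner ℂ (a i) (a j) = 0)
    (h1 : ∀ i, a i = 0 ∨ ‖a i‖ = 1) (x : E) : ∑ i, ‖inner ℂ (a i) x‖ ^ 2 ≤ ‖x‖ ^ 2 := by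
  classical
  have ho : Orthonormal ℂ (fun i : {i // a i ≠ 0} => a i) := by
    refine ⟨fun i => (h1 i).resolve_left i.2, fun i j hij => h0 _ _ fun h => hij (Subtype.ext h)⟩
  have := ho.sum_inner_products_le x (s := Finset.univ)
  refine le_trans (le_of_eq ?_) this
  rw [← Finset.sum_subtype (Finset.univ.filter fun i => a i ≠ 0) (by simp)
    (fun i => ‖inner ℂ (a i) x‖ ^ 2), Finset.sum_filter_of_ne]
  intro i _ h h'
  simp [h'] at h

lemma exists_svd {N : ℕ} (M : Matrix (Fin N) (Fin N) ℂ) :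
    ∃ (b : OrthonormalBasis (Fin N) ℂ (EuclideanSpace ℂ (Fin N)))
      (a : Fin N → EuclideanSpace ℂ (Fin N)) (s : Fin N → ℝ),
      (∀ j, 0 ≤ s j) ∧ (∀ j, Matrix.toEuclideanCLM (𝕜 := ℂ) M (b j) = (s j : ℂ) • a j) ∧
      (∀ j, ‖a j‖ ≤ 1) ∧ (∀ x, ∑ i, ‖inner ℂ (a i) x‖ ^ 2 ≤ ‖x‖ ^ 2) ∧
      (∀ j, (s j : ℂ) = inner ℂ (a j) (Matrix.toEuclideanCLM (𝕜 := ℂ) M (b j))) ∧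
      (∀ p : ℝ, schatten p M = (∑ j, s j ^ p) ^ (1 / p)) := by
  set hp := Matrix.posSemidef_conjTranspose_mul_self M with hhp
  set b := hp.isHermitian.eigenvectorBasis with hb
  set l := hp.isHermitian.eigenvalues with hl
  have hl0 : ∀ j, 0 ≤ l j := hp.eigenvalues_nonneg
  set T := Matrix.toEuclideanCLM (𝕜 := ℂ) M with hT
  have hin : ∀ i j, inner ℂ (T (b i)) (T (b j)) = if i = j then (l j : ℂ) else 0 := by
    intro i j
    rw [hT, inner_conj, ← mul_apply_eq_comp, ← map_mul]
    have : Matrix.toEuclideanCLM (𝕜 := ℂ) (Mᴴ * M) (b j) = (l j : ℂ) • b j := by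
      apply (WithLp.equiv 2 _).injective
      change (Matrix.toEuclideanCLM (𝕜 := ℂ) (Mᴴ * M) (b j)).ofLp = _
      rw [Matrix.ofLp_toEuclideanCLM, hb, Matrix.IsHermitian.mulVec_eigenvectorBasis]
      rfl
    rw [this, inner_smul_right, b.inner_eq_ite]
    simp
  have hsq : ∀ j, ‖T (b j)‖ = √(l j) := by
    intro j
    rw [@norm_eq_sqrt_re_inner ℂ, hin]
    simp
  set s : Fin N → ℝ := fun j => √(l j) with hs
  set a : Fin N → EuclideanSpace ℂ (Fin N) := fun j => ((s j)⁻¹ : ℂ) • T (b j) with ha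
  have ha1 : ∀ j, a j = 0 ∨ ‖a j‖ = 1 := by
    intro j
    by_cases h : s j = 0
    · left; simp [ha, h]
    · right
      have h' : 0 ≤ s j := Real.sqrt_nonneg _
      have : ‖T (b j)‖ = s j := hsq j
      simp only [ha, norm_smul, norm_inv, this, Complex.norm_real, Real.norm_eq_abs, abs_of_nonneg h']
      exact inv_mul_cancel₀ h
  have hTb : ∀ j, T (b j) = (s j : ℂ) • a j := by
    intro j
    by_cases h : s j = 0
    · have : ‖T (b j)‖ = s j := hsq j
      rw [h, norm_eq_zero] at this
      simp [this, h]
    · have h' : (s j : ℂ) ≠ 0 := by exact_mod_cast h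
      simp only [ha, smul_smul, mul_inv_cancel₀ h', one_smul]
  refine ⟨b, a, s, fun j => Real.sqrt_nonneg _, hTb, ?_, ?_, ?_, ?_⟩
  · intro j
    rcases ha1 j with h | h <;> simp [h]
  · apply bessel a _ ha1
    intro i j hij
    simp [ha, inner_smul_left, inner_smul_right, hin, hij]
  · intro j
    rw [hTb j, inner_smul_right]
    rcases ha1 j with h | h
    · have : ‖T (b j)‖ = s j := hsq j
      rw [hTb j, h] at this
      simp at this
      simp [← this]
    · rw [@inner_self_eq_norm_sq_to_K ℂ, h]
      simp
  · intro p
    rw [schatten]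
    congr 1
    apply Finset.sum_congr rfl
    intro j _
    rw [hs]
    simp only
    rw [Real.sqrt_eq_rpow, ← Real.rpow_mul (hl0 j)]
    congr 1
    ring

lemma norm_mul_half (x y : ℂ) : ‖x * y‖ ≤ (‖x‖ ^ 2 + ‖y‖ ^ 2) / 2 := by
  rw [norm_mul]
  nlinarith [sq_nonneg (‖x‖ - ‖y‖)]

lemma substoch {N : ℕ} (p : ℝ) (hp : 1 ≤ p) (w : Fin N → Fin N → ℝ) (s s' : Fin N → ℝ)
    (hs : ∀ j, 0 ≤ s j) (hs' : ∀ j, 0 ≤ s' j) (hw : ∀ i j, 0 ≤ w i j)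
    (hrow : ∀ i, ∑ j, w i j ≤ 1) (hcol : ∀ j, ∑ i, w i j ≤ 1)
    (h : ∀ i, s' i ≤ 2 * ∑ j, w i j * s j) :
    (∑ j, s' j ^ p) ^ (1 / p) ≤ 2 * (∑ j, s j ^ p) ^ (1 / p) := by
  have hp0 : 0 < p := by linarith
  have key : ∀ i, s' i ^ p ≤ 2 ^ p * ∑ j, w i j * s j ^ p := by
    intro i
    have h1 := Real.inner_le_weight_mul_Lp_of_nonneg Finset.univ hp (w i) s (hw i) hs
    have h0 : 0 ≤ ∑ j, w i j * s j ^ p :=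
      Finset.sum_nonneg fun j _ => mul_nonneg (hw i j) (Real.rpow_nonneg (hs j) p)
    have h2 : (∑ j, w i j) ^ (1 - p⁻¹) ≤ 1 := by
      apply Real.rpow_le_one (Finset.sum_nonneg fun j _ => hw i j) (hrow i)
      have := inv_le_one_of_one_le₀ hp
      linarith
    have h3 : ∑ j, w i j * s j ≤ (∑ j, w i j * s j ^ p) ^ p⁻¹ := by
      refine h1.trans ?_
      exact mul_le_of_le_one_left (Real.rpow_nonneg h0 _) h2
    have h4 : s' i ≤ 2 * (∑ j, w i j * s j ^ p) ^ p⁻¹ := (h i).trans (by linarith)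
    calc s' i ^ p ≤ (2 * (∑ j, w i j * s j ^ p) ^ p⁻¹) ^ p :=
          Real.rpow_le_rpow (hs' i) h4 hp0.le
      _ = _ := by
          rw [Real.mul_rpow (by norm_num) (Real.rpow_nonneg h0 _), Real.rpow_inv_rpow h0 hp0.ne']
  have hS : 0 ≤ ∑ j, s j ^ p := Finset.sum_nonneg fun j _ => Real.rpow_nonneg (hs j) p
  have tot : ∑ j, s' j ^ p ≤ 2 ^ p * ∑ j, s j ^ p := by
    calc ∑ j, s' j ^ p ≤ ∑ i, 2 ^ p * ∑ j, w i j * s j ^ p := Finset.sum_le_sum fun i _ => key i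
      _ = 2 ^ p * ∑ j, (∑ i, w i j) * s j ^ p := by
          rw [← Finset.mul_sum, Finset.sum_comm]
          simp only [Finset.sum_mul]
      _ ≤ _ := by
          apply mul_le_mul_of_nonneg_left _ (by positivity)
          apply Finset.sum_le_sum
          intro j _
          exact mul_le_of_le_one_left (Real.rpow_nonneg (hs j) p) (hcol j)
  calc (∑ j, s' j ^ p) ^ (1 / p) ≤ (2 ^ p * ∑ j, s j ^ p) ^ (1 / p) :=
        Real.rpow_le_rpow (Finset.sum_nonneg fun j _ => Real.rpow_nonneg (hs' j) p) tot
          (by positivity)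
    _ = _ := by
        rw [Real.mul_rpow (by positivity) hS, one_div, Real.rpow_rpow_inv (by norm_num) hp0.ne']

lemma schatten_two_le {N : ℕ} (p : ℝ) (hp : 1 ≤ p) (M : Matrix (Fin N) (Fin N) ℂ)
    (R C R' C' : ℕ → Prop) [DecidablePred R] [DecidablePred C] [DecidablePred R']
    [DecidablePred C'] :
    schatten p (coordProj R * M * coordProj C + coordProj R' * M * coordProj C') ≤
      2 * schatten p M := by
  set M' := coordProj R * M * coordProj C + coordProj R' * M * coordProj C' with hM'
  obtain ⟨b, a, s, hs, hT, ha, hB, -, hn⟩ := exists_svd M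
  obtain ⟨b', a', s', hs', -, ha', hB', hi', hn'⟩ := exists_svd M'
  rw [hn, hn']
  let L := fun X : Matrix (Fin N) (Fin N) ℂ => Matrix.toEuclideanCLM (𝕜 := ℂ) X
  -- one-block estimates
  have expand : ∀ u v, inner ℂ u (L M v) = ∑ j, (s j : ℂ) * (inner ℂ u (a j) * inner ℂ (b j) v) := by
    intro u v
    conv_lhs => rw [← b.sum_repr' v]
    simp only [L, map_sum, map_smul, hT, inner_sum, inner_smul_right]
    apply Finset.sum_congr rfl
    intro j _
    ring
  let W : (ℕ → Prop) → (ℕ → Prop) → Fin N → Fin N → ℝ := by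
    classical
    exact fun P Q i j => (‖inner ℂ (L (coordProj P) (a' i)) (a j)‖ ^ 2 +
      ‖inner ℂ (b j) (L (coordProj Q) (b' i))‖ ^ 2) / 2
  have W0 : ∀ P Q i j, 0 ≤ W P Q i j := fun P Q i j => by simp only [W]; positivity
  have sq1 : ∀ x : ℝ, 0 ≤ x → x ≤ 1 → x ^ 2 ≤ 1 := fun x h h' => by nlinarith
  have Wrow : ∀ P Q i, ∑ j, W P Q i j ≤ 1 := by
    intro P Q i
    classical
    simp only [W]
    rw [← Finset.sum_div, Finset.sum_add_distrib]
    have e1 : ∑ j, ‖inner ℂ (L (coordProj P) (a' i)) (a j)‖ ^ 2 ≤ 1 := by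
      simp only [norm_inner_symm _ (a _)]
      refine (hB _).trans (sq1 _ (norm_nonneg _) ((coordProj_norm_le _ _).trans (ha' i)))
    have e2 : ∑ j, ‖inner ℂ (b j) (L (coordProj Q) (b' i))‖ ^ 2 ≤ 1 := by
      rw [b.sum_sq_norm_inner_right]
      exact sq1 _ (norm_nonneg _) ((coordProj_norm_le _ _).trans (b'.norm_eq_one i).le)
    linarith
  have Wcol : ∀ P Q j, ∑ i, W P Q i j ≤ 1 := by
    intro P Q j
    classical
    simp only [W]
    rw [← Finset.sum_div, Finset.sum_add_distrib]
    have e1 : ∑ i, ‖inner ℂ (L (coordProj P) (a' i)) (a j)‖ ^ 2 ≤ 1 := by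
      simp only [L, inner_conj, coordProj_herm]
      refine (hB' _).trans (sq1 _ (norm_nonneg _) ((coordProj_norm_le _ _).trans (ha j)))
    have e2 : ∑ i, ‖inner ℂ (b j) (L (coordProj Q) (b' i))‖ ^ 2 ≤ 1 := by
      have : ∀ i, inner ℂ (b j) (L (coordProj Q) (b' i)) =
          inner ℂ (L (coordProj Q) (b j)) (b' i) := by
        intro i
        simp only [L, inner_conj, coordProj_herm]
      simp only [this]
      rw [b'.sum_sq_norm_inner_left]
      exact sq1 _ (norm_nonneg _) ((coordProj_norm_le _ _).trans (b.norm_eq_one j).le)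
    linarith
  have block : ∀ (P Q : ℕ → Prop) [DecidablePred P] [DecidablePred Q] (i : Fin N),
      ‖inner ℂ (a' i) (L (coordProj P * M * coordProj Q) (b' i))‖ ≤ ∑ j, W P Q i j * s j := by
    intro P Q _ _ i
    have : inner ℂ (a' i) (L (coordProj P * M * coordProj Q) (b' i)) =
        inner ℂ (L (coordProj P) (a' i)) (L M (L (coordProj Q) (b' i))) := by
      simp only [L]
      rw [inner_conj (coordProj P), coordProj_herm, map_mul, map_mul]
      rfl
    rw [this, expand]
    refine (norm_sum_le _ _).trans (Finset.sum_le_sum fun j _ => ?_)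
    rw [norm_mul, Complex.norm_real, Real.norm_of_nonneg (hs j), mul_comm]
    apply mul_le_mul_of_nonneg_right _ (hs j)
    refine (norm_mul_half _ _).trans (le_of_eq ?_)
    simp only [W]
    congr!
  refine substoch p hp (fun i j => (W R C i j + W R' C' i j) / 2) s s' hs hs'
    (fun i j => by have := W0 R C i j; have := W0 R' C' i j; positivity) ?_ ?_ ?_
  · intro i
    rw [← Finset.sum_div, Finset.sum_add_distrib]
    have := Wrow R C i; have := Wrow R' C' i; linarith
  · intro j
    rw [← Finset.sum_div, Finset.sum_add_distrib]
    have := Wcol R C j; have := Wcol R' C' j; linarith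
  · intro i
    have h1 : s' i = ‖(s' i : ℂ)‖ := by
      rw [Complex.norm_real, Real.norm_of_nonneg (hs' i)]
    have h2 : (s' i : ℂ) = inner ℂ (a' i) (L (coordProj R * M * coordProj C) (b' i)) +
        inner ℂ (a' i) (L (coordProj R' * M * coordProj C') (b' i)) := by
      rw [hi' i, hM', map_add, add_apply, inner_add_right]
    rw [h1, h2]
    refine (norm_add_le _ _).trans ((add_le_add (block R C i) (block R' C' i)).trans (le_of_eq ?_))
    rw [← Finset.sum_add_distrib, Finset.mul_sum]
    apply Finset.sum_congr rfl
    intro j _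
    ring

lemma opNorm_two_le {N : ℕ} (M : Matrix (Fin N) (Fin N) ℂ)
    (R C R' C' : ℕ → Prop) [DecidablePred R] [DecidablePred C] [DecidablePred R']
    [DecidablePred C'] :
    opNorm (coordProj R * M * coordProj C + coordProj R' * M * coordProj C') ≤ 2 * opNorm M := by
  have hc : ∀ (P : ℕ → Prop) [DecidablePred P],
      ‖Matrix.toEuclideanCLM (𝕜 := ℂ) (coordProj (N := N) P)‖ ≤ 1 := by
    intro P _
    refine ContinuousLinearMap.opNorm_le_bound _ zero_le_one fun x => ?_
    rw [one_mul]
    exact coordProj_norm_le P x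
  have hb : ∀ (P Q : ℕ → Prop) [DecidablePred P] [DecidablePred Q],
      ‖Matrix.toEuclideanCLM (𝕜 := ℂ) (coordProj (N := N) P * M * coordProj (N := N) Q)‖ ≤ opNorm M := by
    intro P Q _ _
    rw [map_mul, map_mul]
    refine (norm_mul_le _ _).trans ((mul_le_of_le_one_right (norm_nonneg _) (hc Q)).trans ?_)
    exact (norm_mul_le _ _).trans (mul_le_of_le_one_left (norm_nonneg _) (hc P))
  rw [opNorm, map_add]
  refine (norm_add_le _ _).trans ?_
  have := hb R C; have := hb R' C'; linarith

/-- the matrix units in shell enumeration form a basic sequence with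
constant 2 for the right norms `‖·‖_{p,♭}`, `1 ≤ p ≤ ∞`. -/
theorem matrixUnits_basic_sequence_flat
    (α : ℝ) (hα0 : 0 < α) (hα : α ≤ 1 / 2)
    (ν : ℕ) (hν : 1 ≤ ν) (p : ℝ≥0∞) (hp : 1 ≤ p)
    (m : ℕ) (hm : m < 4 ^ ν) (a : ℕ → ℂ) :
    lpFlat α p (∑ j ∈ Finset.range (m + 1), a j • eUnit (2 ^ ν) j) ≤
      2 * lpFlat α p (∑ j ∈ Finset.range (4 ^ ν), a j • eUnit (2 ^ ν) j) := by
  classical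
  obtain ⟨R, C, R', C', h⟩ := shell_decomp m
  set X := ∑ j ∈ Finset.range (4 ^ ν), a j • eUnit (2 ^ ν) j with hX
  have hdec : ∑ j ∈ Finset.range (m + 1), a j • eUnit (2 ^ ν) j =
      coordProj R * X * coordProj C + coordProj R' * X * coordProj C' := by
    ext r c
    have hlt : shellNum r c < 4 ^ ν := by
      have := shellNum_lt r.2 c.2
      rwa [← mul_pow] at this
    have hd := h r c
    rw [sum_eUnit_apply, Matrix.add_apply, coordProj, coordProj, coordProj, coordProj,
      Matrix.mul_diagonal, Matrix.diagonal_mul, Matrix.mul_diagonal, Matrix.diagonal_mul, hX,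
      sum_eUnit_apply, if_pos hlt]
    rw [if_congr (Nat.lt_succ_iff.trans hd.1) rfl rfl]
    have hd2 := hd.2
    by_cases h1 : R r <;> by_cases h2 : C c <;> by_cases h3 : R' r <;> by_cases h4 : C' c <;>
      simp_all
  rw [hdec]
  unfold lpFlat
  split_ifs with hpt
  · exact opNorm_two_le X R C R' C'
  · have hp1 : 1 ≤ p.toReal := by
      rw [← ENNReal.toReal_one]
      exact ENNReal.toReal_mono hpt hp
    obtain ⟨d, hd⟩ := Amatt_diag α (1 / p.toReal) ν
    have hcomm : ∀ P : ℕ → Prop, Amatt α (1 / p.toReal) ν * coordProj P =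
        coordProj P * Amatt α (1 / p.toReal) ν := by
      intro P
      rw [hd, coordProj, Matrix.diagonal_mul_diagonal, Matrix.diagonal_mul_diagonal]
      congr 1
      ext i
      exact mul_comm _ _
    have := schatten_two_le p.toReal hp1 (Amatt α (1 / p.toReal) ν * X) R C R' C'
    convert this using 2
    rw [mul_add]
    simp only [← mul_assoc, hcomm]

end
end

section
/- Let r_0, r_1, r_2, r_3 ∈ M_2(ℂ) satisfy ρ_1(r_j* r_k) = δ_{jk}, and let h^{(ν)}, h^{(ν+1)} be the left Haar systems in N_ν and N_{ν+1}. Suppose c ≥ 0 is such that for every 0 ≤ m < 4^ν and all complex scalars α_j one has ‖Σ_{j=0}^{m} α_j h^{(ν)}_j‖_♯ ≤ c · ‖Σ_{j=0}^{4^ν−1} α_j h^{(ν)}_j‖_♯. Then for every 0 ≤ m < 4^{ν+1} and all complex scalars α_j, ‖Σ_{j=0}^{m} α_j h^{(ν+1)}_j‖_♯ ≤ max{ c·‖r_0‖², ‖r_0‖² + 2(‖r_1‖² + ‖r_2‖² + ‖r_3‖²) } · ‖Σ_{j=0}^{4^{ν+1}−1} α_j h^{(ν+1)}_j‖_♯.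 (Inductive estimate of Theorem 1: c_{ν+1,♯} ≤ max{c_{ν,♯}‖r_0‖², ‖r_0‖² + 2Σ_{q=1}^3 ‖r_q‖²}.) -/
open Finset
open scoped ENNReal ComplexOrder Kronecker Matrix

noncomputable section

section helpers

open scoped Matrix.Norms.L2Operator

lemma opNorm_eq_norm {N : ℕ} (x : Matrix (Fin N) (Fin N) ℂ) : opNorm x = ‖x‖ := rfl

lemma schatten_one {N : ℕ} (x : Matrix (Fin N) (Fin N) ℂ) :
    schatten 1 x =
      ∑ i, √((Matrix.posSemidef_conjTranspose_mul_self x).isHermitian.eigenvalues i) := by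
  simp [schatten, Real.sqrt_eq_rpow]

lemma gram_diag {N : ℕ} (x : Matrix (Fin N) (Fin N) ℂ) :
    ∃ (V : Matrix (Fin N) (Fin N) ℂ) (l : Fin N → ℝ), V * Vᴴ = 1 ∧ Vᴴ * V = 1 ∧
      (∀ i, 0 ≤ l i) ∧ schatten 1 x = ∑ i, √(l i) ∧
      xᴴ * x = V * Matrix.diagonal (fun i => (l i : ℂ)) * Vᴴ := by
  have hA := (Matrix.posSemidef_conjTranspose_mul_self x).isHermitian
  refine ⟨hA.eigenvectorUnitary, hA.eigenvalues, ?_, ?_, ?_, schatten_one x, ?_⟩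
  · exact Unitary.coe_mul_star_self hA.eigenvectorUnitary
  · exact Unitary.coe_star_mul_self hA.eigenvectorUnitary
  · exact (Matrix.posSemidef_conjTranspose_mul_self x).eigenvalues_nonneg
  · have := hA.spectral_theorem
    rw [Unitary.conjStarAlgAut_apply] at this
    exact this

lemma norm_le_one_of_gram {m n : Type*} [Fintype m] [Fintype n] [DecidableEq m] [DecidableEq n]
    (V : Matrix m n ℂ) (h : ‖Vᴴ * V‖ ≤ 1) : ‖V‖ ≤ 1 := by
  rw [Matrix.l2_opNorm_conjTranspose_mul_self] at h
  nlinarith [norm_nonneg V]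

lemma norm_one_le {n : Type*} [Fintype n] [DecidableEq n] : ‖(1 : Matrix n n ℂ)‖ ≤ 1 := by
  rw [← Matrix.diagonal_one, Matrix.l2_opNorm_diagonal]
  exact (pi_norm_le_iff_of_nonneg zero_le_one).2 (by simp)

lemma schatten_one_nonneg {N : ℕ} (x : Matrix (Fin N) (Fin N) ℂ) : 0 ≤ schatten 1 x := by
  rw [schatten_one]; positivity

/-- Trace duality. -/
lemma norm_trace_mul_le {N : ℕ} (u x : Matrix (Fin N) (Fin N) ℂ) :
    ‖(u * x).trace‖ ≤ ‖u‖ * schatten 1 x := by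
  obtain ⟨V, l, h1, h2, hl, hs, hx⟩ := gram_diag x
  have hV : ‖Vᴴ‖ ≤ 1 := norm_le_one_of_gram _ (by
    rw [Matrix.conjTranspose_conjTranspose, h1]; exact norm_one_le)
  have hu : ‖Vᴴ * u‖ ≤ ‖u‖ := by
    refine (Matrix.l2_opNorm_mul _ _).trans ?_
    nlinarith [norm_nonneg u]
  have hy : (x * V)ᴴ * (x * V) = Matrix.diagonal (fun i => (l i : ℂ)) := by
    rw [Matrix.conjTranspose_mul, Matrix.mul_assoc, ← Matrix.mul_assoc xᴴ, hx]
    calc _ = (Vᴴ * V) * Matrix.diagonal (fun i => (l i : ℂ)) * (Vᴴ * V) := by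
          simp only [Matrix.mul_assoc]
      _ = _ := by rw [h2]; simp
  have htr : (u * x).trace = ((Vᴴ * u) * (x * V)).trace := by
    rw [Matrix.mul_assoc Vᴴ, Matrix.trace_mul_comm Vᴴ]
    simp only [Matrix.mul_assoc, h1, Matrix.mul_one]
  rw [htr, hs, Matrix.trace, Finset.mul_sum]
  refine (norm_sum_le _ _).trans (Finset.sum_le_sum fun i _ => ?_)
  have hcol : ‖(WithLp.toLp 2 (fun k => (x * V) k i) : EuclideanSpace ℂ (Fin N))‖ = √(l i) := by
    rw [EuclideanSpace.norm_eq]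
    congr 1
    have := congrFun (congrFun hy i) i
    rw [Matrix.mul_apply, Matrix.diagonal_apply_eq] at this
    have h3 : ((∑ k, ‖(x * V) k i‖ ^ 2 : ℝ) : ℂ) = (l i : ℂ) := by
      rw [← this]
      push_cast
      refine Finset.sum_congr rfl fun k _ => ?_
      rw [Matrix.conjTranspose_apply, RCLike.star_def, Complex.conj_mul']
    exact_mod_cast h3
  have hm := Matrix.l2_opNorm_mulVec (Vᴴ * u)
    (WithLp.toLp 2 (fun k => (x * V) k i) : EuclideanSpace ℂ (Fin N))
  rw [hcol] at hm
  have he := PiLp.norm_apply_le ((EuclideanSpace.equiv (Fin N) ℂ).symm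
    ((Vᴴ * u) *ᵥ (WithLp.toLp 2 (fun k => (x * V) k i) : EuclideanSpace ℂ (Fin N)))) i
  refine le_trans ?_ (he.trans (hm.trans (mul_le_mul_of_nonneg_right hu (Real.sqrt_nonneg _))))
  apply le_of_eq
  rfl

lemma exists_trace_eq {N : ℕ} (x : Matrix (Fin N) (Fin N) ℂ) :
    ∃ u : Matrix (Fin N) (Fin N) ℂ, ‖u‖ ≤ 1 ∧ (u * x).trace = (schatten 1 x : ℂ) := by
  obtain ⟨V, l, h1, h2, hl, hs, hx⟩ := gram_diag x
  have hV : ‖Vᴴ‖ ≤ 1 := norm_le_one_of_gram _ (by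
    rw [Matrix.conjTranspose_conjTranspose, h1]; exact norm_one_le)
  have hV' : ‖V‖ ≤ 1 := norm_le_one_of_gram _ (by rw [h2]; exact norm_one_le)
  set D : Matrix (Fin N) (Fin N) ℂ := Matrix.diagonal (fun i => (((√(l i))⁻¹ : ℝ) : ℂ)) with hD
  have hDD : Dᴴ = D := by
    rw [hD, Matrix.diagonal_conjTranspose]; congr 1; ext i; simp
  refine ⟨V * D * Vᴴ * xᴴ, ?_, ?_⟩
  · rw [← Matrix.l2_opNorm_conjTranspose]
    apply norm_le_one_of_gram
    have : (V * D * Vᴴ * xᴴ)ᴴᴴ * (V * D * Vᴴ * xᴴ)ᴴ =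
        V * (D * Matrix.diagonal (fun i => (l i : ℂ)) * D) * Vᴴ := by
      simp only [Matrix.conjTranspose_mul, Matrix.conjTranspose_conjTranspose, hDD]
      calc _ = V * D * Vᴴ * (xᴴ * x) * V * D * Vᴴ := by simp only [Matrix.mul_assoc]
        _ = V * D * (Vᴴ * V) * Matrix.diagonal (fun i => (l i : ℂ)) * (Vᴴ * V) * D * Vᴴ := by
            rw [hx]; simp only [Matrix.mul_assoc]
        _ = _ := by rw [h2]; simp only [Matrix.mul_assoc, Matrix.one_mul]
    rw [this]
    have hn : ‖D * Matrix.diagonal (fun i => (l i : ℂ)) * D‖ ≤ 1 := by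
      rw [hD, Matrix.diagonal_mul_diagonal, Matrix.diagonal_mul_diagonal,
        Matrix.l2_opNorm_diagonal]
      refine (pi_norm_le_iff_of_nonneg zero_le_one).2 fun i => ?_
      rw [← Complex.ofReal_mul, ← Complex.ofReal_mul, Complex.norm_real]
      have := Real.mul_self_sqrt (hl i)
      by_cases h0 : √(l i) = 0
      · simp [h0]
      · nth_rewrite 2 [← this]
        field_simp
        simp
    refine (Matrix.l2_opNorm_mul _ _).trans (mul_le_one₀ ?_ (norm_nonneg _) hV)
    exact (Matrix.l2_opNorm_mul _ _).trans (mul_le_one₀ hV' (norm_nonneg _) hn)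
  · rw [Matrix.mul_assoc, hx]
    have : (V * D * Vᴴ * (V * Matrix.diagonal (fun i => (l i : ℂ)) * Vᴴ)).trace =
        (D * Matrix.diagonal (fun i => (l i : ℂ))).trace := by
      calc _ = (V * (D * (Vᴴ * V) * Matrix.diagonal (fun i => (l i : ℂ)) * Vᴴ)).trace := by
            simp only [Matrix.mul_assoc]
        _ = _ := by
            rw [h2, Matrix.trace_mul_comm, Matrix.mul_assoc, h2]; simp
    rw [this, hs, hD, Matrix.diagonal_mul_diagonal, Matrix.trace_diagonal]
    push_cast
    refine Finset.sum_congr rfl fun i _ => ?_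
    rw [← Complex.ofReal_inv, ← Complex.ofReal_mul]
    congr 1
    have := Real.mul_self_sqrt (hl i)
    by_cases h0 : √(l i) = 0
    · simp [h0]
    · nth_rewrite 2 [← this]
      field_simp

lemma schatten_le_of_dual {N : ℕ} (x : Matrix (Fin N) (Fin N) ℂ) (K : ℝ)
    (h : ∀ u : Matrix (Fin N) (Fin N) ℂ, ‖u‖ ≤ 1 → ‖(u * x).trace‖ ≤ K) : schatten 1 x ≤ K := by
  obtain ⟨u, hu, ht⟩ := exists_trace_eq x
  have := h u hu
  rw [ht, Complex.norm_real] at this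
  exact (le_abs_self _).trans this

lemma schatten_add_le {N : ℕ} (x y : Matrix (Fin N) (Fin N) ℂ) :
    schatten 1 (x + y) ≤ schatten 1 x + schatten 1 y := by
  refine schatten_le_of_dual _ _ fun u hu => ?_
  rw [Matrix.mul_add, Matrix.trace_add]
  refine (norm_add_le _ _).trans (add_le_add ?_ ?_)
  · refine (norm_trace_mul_le u x).trans (mul_le_of_le_one_left (schatten_one_nonneg x) hu)
  · refine (norm_trace_mul_le u y).trans (mul_le_of_le_one_left (schatten_one_nonneg y) hu)

lemma schatten_mul_mul_le {N : ℕ} (a x b : Matrix (Fin N) (Fin N) ℂ) (ha : ‖a‖ ≤ 1)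
    (hb : ‖b‖ ≤ 1) : schatten 1 (a * x * b) ≤ schatten 1 x := by
  refine schatten_le_of_dual _ _ fun u hu => ?_
  have : (u * (a * x * b)).trace = ((b * (u * a)) * x).trace := by
    rw [← Matrix.mul_assoc, Matrix.trace_mul_comm]
    simp only [Matrix.mul_assoc]
  rw [this]
  refine (norm_trace_mul_le _ x).trans (mul_le_of_le_one_left (schatten_one_nonneg x) ?_)
  refine (Matrix.l2_opNorm_mul _ _).trans (mul_le_one₀ hb (norm_nonneg _) ?_)
  exact (Matrix.l2_opNorm_mul _ _).trans (mul_le_one₀ hu (norm_nonneg _) ha)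

/-! Kronecker products -/

lemma kron_apply {m n : ℕ} (x : Matrix (Fin m) (Fin m) ℂ) (y : Matrix (Fin n) (Fin n) ℂ)
    (i j : Fin m × Fin n) :
    kron x y (finProdFinEquiv i) (finProdFinEquiv j) = x i.1 j.1 * y i.2 j.2 := by
  simp only [kron, Matrix.reindex_apply, Matrix.submatrix_apply, Equiv.symm_apply_apply,
    Matrix.kroneckerMap_apply]

lemma kron_ext {m n : ℕ} {X Y : Matrix (Fin (m * n)) (Fin (m * n)) ℂ}
    (h : ∀ i j : Fin m × Fin n, X (finProdFinEquiv i) (finProdFinEquiv j) =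
      Y (finProdFinEquiv i) (finProdFinEquiv j)) : X = Y := by
  ext i j
  have := h (finProdFinEquiv.symm i) (finProdFinEquiv.symm j)
  simpa only [Equiv.apply_symm_apply] using this

lemma kron_mul {m n : ℕ} (x x' : Matrix (Fin m) (Fin m) ℂ) (y y' : Matrix (Fin n) (Fin n) ℂ) :
    kron x y * kron x' y' = kron (x * x') (y * y') := by
  simp only [kron, Matrix.mul_kronecker_mul, Matrix.reindex_apply, Matrix.submatrix_mul_equiv]

lemma trace_kron {m n : ℕ} (x : Matrix (Fin m) (Fin m) ℂ) (y : Matrix (Fin n) (Fin n) ℂ) :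
    (kron x y).trace = x.trace * y.trace := by
  rw [← Matrix.trace_kronecker, kron, Matrix.trace, Matrix.trace]
  rw [← finProdFinEquiv.sum_comp]
  refine Finset.sum_congr rfl fun i _ => ?_
  simp

lemma kron_add_left {m n : ℕ} (x x' : Matrix (Fin m) (Fin m) ℂ) (y : Matrix (Fin n) (Fin n) ℂ) :
    kron (x + x') y = kron x y + kron x' y := by
  refine kron_ext fun i j => ?_
  simp only [Matrix.add_apply, kron_apply, add_mul]

lemma kron_add_right {m n : ℕ} (x : Matrix (Fin m) (Fin m) ℂ) (y y' : Matrix (Fin n) (Fin n) ℂ) :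
    kron x (y + y') = kron x y + kron x y' := by
  refine kron_ext fun i j => ?_
  simp only [Matrix.add_apply, kron_apply, mul_add]

lemma kron_smul_left {m n : ℕ} (c : ℂ) (x : Matrix (Fin m) (Fin m) ℂ)
    (y : Matrix (Fin n) (Fin n) ℂ) :
    kron (c • x) y = c • kron x y := by
  refine kron_ext fun i j => ?_
  simp only [Matrix.smul_apply, kron_apply, smul_eq_mul, mul_assoc]

lemma kron_smul_right {m n : ℕ} (c : ℂ) (x : Matrix (Fin m) (Fin m) ℂ)
    (y : Matrix (Fin n) (Fin n) ℂ) :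
    kron x (c • y) = c • kron x y := by
  refine kron_ext fun i j => ?_
  simp only [Matrix.smul_apply, kron_apply, smul_eq_mul, mul_left_comm]

lemma kron_zero_left {m n : ℕ} (y : Matrix (Fin n) (Fin n) ℂ) :
    kron (0 : Matrix (Fin m) (Fin m) ℂ) y = 0 := by
  refine kron_ext fun i j => ?_
  simp only [Matrix.zero_apply, kron_apply, zero_mul]

lemma kron_zero_right {m n : ℕ} (x : Matrix (Fin m) (Fin m) ℂ) :
    kron x (0 : Matrix (Fin n) (Fin n) ℂ) = 0 := by
  refine kron_ext fun i j => ?_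
  simp only [Matrix.zero_apply, kron_apply, mul_zero]

lemma kron_sum_left {ι : Type*} {m n : ℕ} (s : Finset ι) (x : ι → Matrix (Fin m) (Fin m) ℂ)
    (y : Matrix (Fin n) (Fin n) ℂ) :
    kron (∑ i ∈ s, x i) y = ∑ i ∈ s, kron (x i) y := by
  classical
  induction s using Finset.induction_on with
  | empty => simp [kron_zero_left]
  | insert a s ha ih => rw [Finset.sum_insert ha, Finset.sum_insert ha, kron_add_left, ih]

lemma kron_star {m n : ℕ} (x : Matrix (Fin m) (Fin m) ℂ) (y : Matrix (Fin n) (Fin n) ℂ) :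
    (kron x y)ᴴ = kron xᴴ yᴴ := by
  refine kron_ext fun i j => ?_
  simp only [Matrix.conjTranspose_apply, kron_apply, star_mul']

lemma norm_kron_one {m n : ℕ} (x : Matrix (Fin m) (Fin m) ℂ) :
    ‖kron x (1 : Matrix (Fin n) (Fin n) ℂ)‖ ≤ ‖x‖ := by
  let φ : Matrix (Fin m) (Fin m) ℂ →⋆ₙₐ[ℂ] Matrix (Fin (m * n)) (Fin (m * n)) ℂ :=
    { toFun := fun x => kron x 1
      map_smul' := fun c x => kron_smul_left c x 1
      map_zero' := kron_zero_left 1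
      map_add' := fun x y => kron_add_left x y 1
      map_mul' := fun x y => by rw [kron_mul, Matrix.mul_one]
      map_star' := fun x => by
        simp only [Matrix.star_eq_conjTranspose, kron_star, Matrix.conjTranspose_one] }
  exact NonUnitalStarAlgHom.norm_apply_le φ x

lemma norm_one_kron {m n : ℕ} (x : Matrix (Fin n) (Fin n) ℂ) :
    ‖kron (1 : Matrix (Fin m) (Fin m) ℂ) x‖ ≤ ‖x‖ := by
  let φ : Matrix (Fin n) (Fin n) ℂ →⋆ₙₐ[ℂ] Matrix (Fin (m * n)) (Fin (m * n)) ℂ :=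
    { toFun := fun x => kron 1 x
      map_smul' := fun c x => kron_smul_right c 1 x
      map_zero' := kron_zero_right 1
      map_add' := fun x y => kron_add_right 1 x y
      map_mul' := fun x y => by rw [kron_mul, Matrix.mul_one]
      map_star' := fun x => by
        simp only [Matrix.star_eq_conjTranspose, kron_star, Matrix.conjTranspose_one] }
  exact NonUnitalStarAlgHom.norm_apply_le φ x

/-- the isometry `e ↦ e ⊗ e_i` -/
def isoV (m n : ℕ) (i : Fin n) : Matrix (Fin (m * n)) (Fin m) ℂ :=
  Matrix.of fun a b => if a = finProdFinEquiv (b, i) then 1 else 0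

lemma norm_isoV (m n : ℕ) (i : Fin n) : ‖isoV m n i‖ ≤ 1 := by
  apply norm_le_one_of_gram
  have : (isoV m n i)ᴴ * isoV m n i = 1 := by
    ext a b
    simp [Matrix.mul_apply, isoV, Matrix.one_apply, eq_comm]
  rw [this]; exact norm_one_le

lemma kron_diag {m n : ℕ} (x : Matrix (Fin m) (Fin m) ℂ) (d : Fin n → ℂ) :
    kron x (Matrix.diagonal d) = ∑ i, d i • (isoV m n i * x * (isoV m n i)ᴴ) := by
  refine kron_ext fun a b => ?_
  obtain ⟨a1, a2⟩ := a
  obtain ⟨b1, b2⟩ := b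
  rw [kron_apply, Matrix.sum_apply]
  have hterm : ∀ i : Fin n, (d i • (isoV m n i * x * (isoV m n i)ᴴ)) (finProdFinEquiv (a1, a2))
      (finProdFinEquiv (b1, b2)) = if a2 = i then (if b2 = i then d i * x a1 b1 else 0) else 0 := by
    intro i
    rw [Matrix.smul_apply, Matrix.mul_apply]
    by_cases h1 : a2 = i <;> by_cases h2 : b2 = i <;>
      simp [Matrix.mul_apply, isoV, h1, h2]
  rw [Finset.sum_congr rfl fun i _ => hterm i, Finset.sum_ite_eq, if_pos (Finset.mem_univ _),
    Matrix.diagonal_apply]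
  by_cases h : a2 = b2
  · simp [h, mul_comm]
  · simp [h, Ne.symm h]

lemma schatten_kron_le (α : ℝ) (hα0 : 0 < α) (hα : α ≤ 1 / 2) {N : ℕ}
    (x A : Matrix (Fin N) (Fin N) ℂ) (r : Matrix (Fin 2) (Fin 2) ℂ) :
    schatten 1 (kron x r * kron A (A1 α)) ≤ ‖r‖ * schatten 1 (x * A) := by
  refine schatten_le_of_dual _ _ fun u hu => ?_
  have h1 : kron x r * kron A (A1 α) = kron 1 r * kron (x * A) (A1 α) := by
    rw [kron_mul, kron_mul, Matrix.one_mul]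
  rw [h1, ← Matrix.mul_assoc]
  set w := u * kron (1 : Matrix (Fin N) (Fin N) ℂ) r with hw
  have hwn : ‖w‖ ≤ ‖r‖ := by
    refine (Matrix.l2_opNorm_mul _ _).trans ?_
    have := norm_one_kron (m := N) r
    nlinarith [norm_nonneg u, norm_nonneg (kron (1 : Matrix (Fin N) (Fin N) ℂ) r)]
  have key : ∀ i : Fin 2, ‖(w * (isoV N 2 i * (x * A) * (isoV N 2 i)ᴴ)).trace‖ ≤
      ‖r‖ * schatten 1 (x * A) := by
    intro i
    have : (w * (isoV N 2 i * (x * A) * (isoV N 2 i)ᴴ)).trace =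
        (((isoV N 2 i)ᴴ * (w * isoV N 2 i)) * (x * A)).trace := by
      rw [← Matrix.mul_assoc w, Matrix.trace_mul_comm]
      simp only [Matrix.mul_assoc]
    rw [this]
    refine (norm_trace_mul_le _ _).trans
      (mul_le_mul_of_nonneg_right ?_ (schatten_one_nonneg _))
    have hv := norm_isoV N 2 i
    have hv' : ‖(isoV N 2 i)ᴴ‖ ≤ 1 := by rwa [Matrix.l2_opNorm_conjTranspose]
    refine (Matrix.l2_opNorm_mul _ _).trans ?_
    have h2 : ‖w * isoV N 2 i‖ ≤ ‖r‖ :=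
      (Matrix.l2_opNorm_mul _ _).trans
        ((mul_le_of_le_one_right (norm_nonneg _) hv).trans hwn)
    exact (mul_le_of_le_one_left (norm_nonneg _) hv').trans h2
  rw [A1, kron_diag, Fin.sum_univ_two, Matrix.mul_add, Matrix.trace_add, Matrix.mul_smul,
    Matrix.mul_smul, Matrix.trace_smul, Matrix.trace_smul]
  refine (norm_add_le _ _).trans ?_
  rw [norm_smul, norm_smul]
  have k0 := key 0
  have k1 := key 1
  have n0 : ‖(![(α : ℂ), ((1 - α : ℝ) : ℂ)] : Fin 2 → ℂ) 0‖ = α := by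
    simp [abs_of_pos hα0]
  have n1 : ‖(![(α : ℂ), ((1 - α : ℝ) : ℂ)] : Fin 2 → ℂ) 1‖ = 1 - α := by
    rw [Matrix.cons_val_one, Matrix.cons_val_fin_one, Complex.norm_real, Real.norm_eq_abs,
      abs_of_pos (by linarith)]
  rw [n0, n1]
  nlinarith

lemma schatten_coeff_le (α : ℝ) {N : ℕ} (A : Matrix (Fin N) (Fin N) ℂ)
    (r : ℕ → Matrix (Fin 2) (Fin 2) ℂ)
    (hr : ∀ j < 4, ∀ k < 4, rho1 α ((r j)ᴴ * r k) = if j = k then 1 else 0)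
    (x : ℕ → Matrix (Fin N) (Fin N) ℂ) (q : ℕ) (hq : q < 4) :
    schatten 1 (x q * A) ≤
      ‖r q‖ * schatten 1 ((∑ p ∈ Finset.range 4, kron (x p) (r p)) * kron A (A1 α)) := by
  refine schatten_le_of_dual _ _ fun u hu => ?_
  set Y := (∑ p ∈ Finset.range 4, kron (x p) (r p)) * kron A (A1 α) with hY
  have h1 : ((kron u 1 * kron 1 (r q)ᴴ) * Y).trace = (u * (x q * A)).trace := by
    rw [hY, Finset.sum_mul, Finset.mul_sum, Matrix.trace_sum]
    have : ∀ p ∈ Finset.range 4,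
        (kron u 1 * kron 1 (r q)ᴴ * (kron (x p) (r p) * kron A (A1 α))).trace =
          if q = p then (u * (x p * A)).trace else 0 := by
      intro p hp
      have h := hr q hq p (Finset.mem_range.1 hp)
      rw [rho1] at h
      rw [kron_mul, kron_mul, kron_mul, trace_kron, Matrix.one_mul, Matrix.mul_one,
        ← Matrix.mul_assoc (r q)ᴴ, h]
      split_ifs <;> simp
    rw [Finset.sum_congr rfl this, Finset.sum_ite_eq, if_pos (Finset.mem_range.2 hq)]
  rw [← h1]
  refine (norm_trace_mul_le _ _).trans (mul_le_mul_of_nonneg_right ?_ (schatten_one_nonneg _))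
  refine (Matrix.l2_opNorm_mul _ _).trans ?_
  have a1 := (norm_kron_one (n := 2) u).trans hu
  have a2 := norm_one_kron (m := N) (r q)ᴴ
  rw [Matrix.l2_opNorm_conjTranspose] at a2
  exact (mul_le_of_le_one_left (norm_nonneg _) a1).trans a2

/-! Shell truncations -/

/-- restriction to a set of indices -/
def restr (N : ℕ) (P : ℕ → Prop) [DecidablePred P] : Matrix (Fin N) (Fin N) ℂ :=
  Matrix.diagonal fun i => if P i then 1 else 0

lemma norm_restr (N : ℕ) (P : ℕ → Prop) [DecidablePred P] : ‖restr N P‖ ≤ 1 := by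
  rw [restr, Matrix.l2_opNorm_diagonal]
  refine (pi_norm_le_iff_of_nonneg zero_le_one).2 fun i => ?_
  split_ifs <;> simp

lemma restr_apply {N : ℕ} (P Q : ℕ → Prop) [DecidablePred P] [DecidablePred Q]
    (y : Matrix (Fin N) (Fin N) ℂ) (i j : Fin N) :
    (restr N P * y * restr N Q) i j = if P i ∧ Q j then y i j else 0 := by
  rw [restr, restr, Matrix.mul_diagonal, Matrix.diagonal_mul]
  by_cases h1 : P i <;> by_cases h2 : Q j <;> simp [h1, h2]

lemma shell_structure (m : ℕ) : ∃ (R1 C1 R2 C2 : ℕ → Prop),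
    ∀ i j, (shellNum i j < m ↔ (R1 i ∧ C1 j) ∨ (R2 i ∧ C2 j)) ∧
      ¬ ((R1 i ∧ C1 j) ∧ (R2 i ∧ C2 j)) := by
  obtain ⟨s, hs1, hs2⟩ : ∃ s, s * s ≤ m ∧ m < (s + 1) * (s + 1) :=
    ⟨Nat.sqrt m, Nat.sqrt_le m, Nat.lt_succ_sqrt m⟩
  obtain ⟨t, rfl⟩ := Nat.exists_eq_add_of_le hs1
  have ht : t ≤ 2 * s := by nlinarith
  have hsh : ∀ i j, (i < s ∧ j < s → shellNum i j < s * s) ∧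
      (s < i ∨ s < j → s * s + 2 * s + 1 ≤ shellNum i j) ∧
      (i ≤ s → shellNum i s = s * s + i) ∧ (j < s → shellNum s j = s * s + 2 * s - j) := by
    intro i j
    unfold shellNum
    refine ⟨fun h => ?_, fun h => ?_, fun h => by rw [if_pos h], fun h => by
      rw [if_neg (by omega)]⟩
    · split_ifs
      · nlinarith
      · have : i * i + 2 * i < s * s := by nlinarith
        omega
    · split_ifs
      · have : s < j := by omega
        nlinarith
      · have : s < i := by omega
        have : s * s + 2 * s + 1 ≤ i * i := by nlinarith
        omega
  have hcmp : ∀ i j, (i < s ∧ j < s) ∨ (s < i ∨ s < j) ∨ (i ≤ s ∧ j = s) ∨ (i = s ∧ j < s) := by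
    intro i j; omega
  by_cases hts : t ≤ s
  · refine ⟨fun i => i < t, fun j => j ≤ s, fun i => t ≤ i ∧ i < s, fun j => j < s, ?_⟩
    intro i j
    refine ⟨?_, by omega⟩
    obtain ⟨a1, a2, a3, a4⟩ := hsh i j
    rcases hcmp i j with h | h | h | h
    · have := a1 h; omega
    · have := a2 h; omega
    · obtain ⟨h, rfl⟩ := h
      have := a3 h; omega
    · obtain ⟨rfl, h⟩ := h
      have := a4 h; omega
  · refine ⟨fun i => i < s, fun j => j ≤ s, fun i => i = s, fun j => j ≤ s ∧ 2 * s < t + j, ?_⟩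
    intro i j
    refine ⟨?_, by omega⟩
    obtain ⟨a1, a2, a3, a4⟩ := hsh i j
    rcases hcmp i j with h | h | h | h
    · have := a1 h; omega
    · have := a2 h; omega
    · obtain ⟨h, rfl⟩ := h
      have := a3 h; omega
    · obtain ⟨rfl, h⟩ := h
      have := a4 h; omega

lemma shellNum_lt_s3 {N : ℕ} (i j : Fin N) : shellNum i j < N * N := by
  have hi := i.2
  have hj := j.2
  unfold shellNum
  split_ifs with h
  · nlinarith
  · have : (i : ℕ) * i + 2 * i < N * N := by nlinarith
    omega

lemma shell_sum_apply {N : ℕ} (b : ℕ → ℂ) (t : ℕ) (i j : Fin N) :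
    (∑ k ∈ Finset.range t, b k • eUnit N k) i j =
      if shellNum i j < t then b (shellNum i j) else 0 := by
  rw [Matrix.sum_apply]
  simp [eUnit]

lemma schatten_shell_le {N : ℕ} (d : Fin N → ℂ) (b : ℕ → ℂ) (t : ℕ) :
    schatten 1 ((∑ k ∈ Finset.range t, b k • eUnit N k) * Matrix.diagonal d) ≤
      2 * schatten 1 ((∑ k ∈ Finset.range (N * N), b k • eUnit N k) * Matrix.diagonal d) := by
  classical
  obtain ⟨R1, C1, R2, C2, h⟩ := shell_structure t
  set y := ∑ k ∈ Finset.range (N * N), b k • eUnit N k with hy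
  have e1 : ∑ k ∈ Finset.range t, b k • eUnit N k =
      restr N R1 * y * restr N C1 + restr N R2 * y * restr N C2 := by
    ext i j
    rw [Matrix.add_apply, restr_apply, restr_apply, shell_sum_apply, hy, shell_sum_apply,
      if_pos (shellNum_lt_s3 i j)]
    obtain ⟨g1, g2⟩ := h i j
    by_cases p1 : R1 i ∧ C1 j
    · have p2 : ¬ (R2 i ∧ C2 j) := fun p2 => g2 ⟨p1, p2⟩
      rw [if_pos (g1.2 (Or.inl p1)), if_pos p1, if_neg p2, add_zero]
    · by_cases p2 : R2 i ∧ C2 j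
      · rw [if_pos (g1.2 (Or.inr p2)), if_neg p1, if_pos p2, zero_add]
      · rw [if_neg (fun q => (g1.1 q).elim p1 p2), if_neg p1, if_neg p2, add_zero]
  have comm : ∀ (C : ℕ → Prop), restr N C * Matrix.diagonal d = Matrix.diagonal d * restr N C := by
    intro C
    rw [restr, Matrix.diagonal_mul_diagonal, Matrix.diagonal_mul_diagonal]
    simp only [mul_comm]
  have e2 : ∀ (R C : ℕ → Prop), restr N R * y * restr N C * Matrix.diagonal d =
      restr N R * (y * Matrix.diagonal d) * restr N C := by
    intro R C
    rw [Matrix.mul_assoc, comm]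
    simp only [Matrix.mul_assoc]
  rw [e1, Matrix.add_mul, e2, e2, two_mul]
  exact (schatten_add_le _ _).trans (add_le_add
    (schatten_mul_mul_le _ _ _ (norm_restr N R1) (norm_restr N C1))
    (schatten_mul_mul_le _ _ _ (norm_restr N R2) (norm_restr N C2)))

lemma Amat_diag (α : ℝ) (ν : ℕ) : ∃ d, Amat α ν = Matrix.diagonal d := by
  induction ν with
  | zero => exact ⟨fun _ => 1, by rw [Amat, Matrix.diagonal_one]⟩
  | succ ν ih =>
    obtain ⟨d, hd⟩ := ih
    have : ∀ (m n : ℕ) (d : Fin m → ℂ) (e : Fin n → ℂ),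
        ∃ f, kron (Matrix.diagonal d) (Matrix.diagonal e) = Matrix.diagonal f := by
      intro m n d e
      refine ⟨fun i => d (finProdFinEquiv.symm i).1 * e (finProdFinEquiv.symm i).2, ?_⟩
      refine kron_ext fun i j => ?_
      rw [kron_apply, Matrix.diagonal_apply, Matrix.diagonal_apply, Matrix.diagonal_apply,
        Equiv.symm_apply_apply]
      obtain ⟨i1, i2⟩ := i
      obtain ⟨j1, j2⟩ := j
      by_cases h1 : i1 = j1 <;> by_cases h2 : i2 = j2 <;> simp [h1, h2]
    rw [Amat, hd, A1]
    exact this _ _ _ _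

/-- The block sums: everything below `4^ν q + t`. -/
lemma sum_range_block {E : Type*} [AddCommMonoid E] (f : ℕ → E) (M q t : ℕ) :
    ∑ j ∈ Finset.range (M * q + t), f j =
      (∑ p ∈ Finset.range q, ∑ k ∈ Finset.range M, f (M * p + k)) +
        ∑ k ∈ Finset.range t, f (M * q + k) := by
  rw [Finset.sum_range_add]
  congr 1
  induction q with
  | zero => simp
  | succ q ih => rw [Nat.mul_succ, Finset.sum_range_add, ih, Finset.sum_range_succ]

lemma abstract_bound (α : ℝ) (hα0 : 0 < α) (hα : α ≤ 1 / 2) {N : ℕ}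
    (d : Fin N → ℂ) (r : ℕ → Matrix (Fin 2) (Fin 2) ℂ)
    (hr : ∀ j < 4, ∀ k < 4, rho1 α ((r j)ᴴ * r k) = if j = k then 1 else 0)
    (c : ℝ) (hc : 0 ≤ c) (h : ℕ → Matrix (Fin N) (Fin N) ℂ)
    (hbase : ∀ m < N * N, ∀ a : ℕ → ℂ,
      schatten 1 ((∑ j ∈ Finset.range (m + 1), a j • h j) * Matrix.diagonal d) ≤
        c * schatten 1 ((∑ j ∈ Finset.range (N * N), a j • h j) * Matrix.diagonal d))
    (H : ℕ → Matrix (Fin (N * 2)) (Fin (N * 2)) ℂ)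
    (H0 : ∀ k < N * N, H k = kron (h k) (r 0))
    (H1 : ∀ q < 4, q ≠ 0 → ∀ k < N * N, H (N * N * q + k) = kron (eUnit N k) (r q))
    (m : ℕ) (hm : m < N * N * 4) (a : ℕ → ℂ) :
    schatten 1 ((∑ j ∈ Finset.range (m + 1), a j • H j) * kron (Matrix.diagonal d) (A1 α)) ≤
      max (c * ‖r 0‖ ^ 2) (‖r 0‖ ^ 2 + 2 * (‖r 1‖ ^ 2 + ‖r 2‖ ^ 2 + ‖r 3‖ ^ 2)) *
      schatten 1 ((∑ j ∈ Finset.range (N * N * 4), a j • H j) *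
        kron (Matrix.diagonal d) (A1 α)) := by
  set M := N * N with hM
  set D := Matrix.diagonal d with hD
  -- partial coefficient
  let y : ℕ → ℕ → Matrix (Fin N) (Fin N) ℂ := fun q t =>
    if q = 0 then ∑ k ∈ Finset.range t, a k • h k
    else ∑ k ∈ Finset.range t, a (M * q + k) • eUnit N k
  have hy : ∀ q < 4, ∀ t ≤ M, ∑ k ∈ Finset.range t, a (M * q + k) • H (M * q + k) =
      kron (y q t) (r q) := by
    intro q hq t ht
    by_cases h0 : q = 0
    · subst h0
      simp only [y, if_pos, kron_sum_left, mul_zero, zero_add]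
      refine Finset.sum_congr rfl fun k hk => ?_
      rw [H0 k ((Finset.mem_range.1 hk).trans_le ht), kron_smul_left]
    · simp only [y, if_neg h0, kron_sum_left]
      refine Finset.sum_congr rfl fun k hk => ?_
      rw [H1 q hq h0 k ((Finset.mem_range.1 hk).trans_le ht), kron_smul_left]
  have hsum : ∀ q ≤ 4, ∑ p ∈ Finset.range q, ∑ k ∈ Finset.range M, a (M * p + k) • H (M * p + k) =
      ∑ p ∈ Finset.range q, kron (y p M) (r p) := fun q hq =>
    Finset.sum_congr rfl fun p hp => hy p ((Finset.mem_range.1 hp).trans_le hq) M le_rfl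
  have hfull : ∑ j ∈ Finset.range (M * 4), a j • H j =
      ∑ p ∈ Finset.range 4, kron (y p M) (r p) := by
    have := sum_range_block (fun j => a j • H j) M 4 0
    simp only [add_zero, Finset.range_zero, Finset.sum_empty] at this
    rw [this, hsum 4 le_rfl]
  have hMpos : 0 < M := by omega
  obtain ⟨q, t, ht, hqt⟩ : ∃ q t, t < M ∧ m = M * q + t :=
    ⟨m / M, m % M, Nat.mod_lt _ hMpos, (Nat.div_add_mod m M).symm⟩
  have hq : q < 4 := by
    by_contra hcon
    push Not at hcon
    have : M * 4 ≤ M * q := Nat.mul_le_mul_left _ hcon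
    omega
  have hpart : ∑ j ∈ Finset.range (m + 1), a j • H j =
      (∑ p ∈ Finset.range q, kron (y p M) (r p)) + kron (y q (t + 1)) (r q) := by
    rw [hqt, add_assoc, sum_range_block (fun j => a j • H j) M q (t + 1), hsum q hq.le,
      hy q hq (t + 1) ht]
  rw [hpart, hfull]
  set S := schatten 1 ((∑ p ∈ Finset.range 4, kron (y p M) (r p)) * kron D (A1 α)) with hS
  have hS0 : 0 ≤ S := schatten_one_nonneg _
  have hcoef : ∀ p < 4, schatten 1 (y p M * D) ≤ ‖r p‖ * S := fun p hp =>
    schatten_coeff_le α D r hr (fun p => y p M) p hp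
  have hfullterm : ∀ p < 4, schatten 1 (kron (y p M) (r p) * kron D (A1 α)) ≤ ‖r p‖ ^ 2 * S := by
    intro p hp
    refine (schatten_kron_le α hα0 hα (y p M) D (r p)).trans ?_
    calc _ ≤ ‖r p‖ * (‖r p‖ * S) := mul_le_mul_of_nonneg_left (hcoef p hp) (norm_nonneg _)
      _ = _ := by ring
  by_cases h0 : q = 0
  · subst h0
    rw [Finset.range_zero, Finset.sum_empty, zero_add]
    refine (schatten_kron_le α hα0 hα _ D (r 0)).trans ?_
    have hb := hbase t ht a
    have hc0 := hcoef 0 hq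
    have e1 : y 0 (t + 1) = ∑ j ∈ Finset.range (t + 1), a j • h j := by simp [y]
    have e2 : y 0 M = ∑ j ∈ Finset.range M, a j • h j := by simp [y]
    rw [e2] at hc0
    rw [e1]
    calc _ ≤ ‖r 0‖ * (c * (‖r 0‖ * S)) := mul_le_mul_of_nonneg_left
            (hb.trans (mul_le_mul_of_nonneg_left hc0 hc)) (norm_nonneg _)
      _ = (c * ‖r 0‖ ^ 2) * S := by ring
      _ ≤ _ := mul_le_mul_of_nonneg_right (le_max_left _ _) hS0
  · refine le_trans ?_ (mul_le_mul_of_nonneg_right (le_max_right _ _) hS0)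
    have hlast : schatten 1 (kron (y q (t + 1)) (r q) * kron D (A1 α)) ≤ 2 * ‖r q‖ ^ 2 * S := by
      refine (schatten_kron_le α hα0 hα _ D (r q)).trans ?_
      have hb := schatten_shell_le d (fun k => a (M * q + k)) (t + 1)
      have hc0 := hcoef q hq
      have e1 : ∀ t, y q t = ∑ k ∈ Finset.range t, a (M * q + k) • eUnit N k := by
        intro t; simp [y, h0]
      rw [e1] at hc0
      rw [e1]
      calc _ ≤ ‖r q‖ * (2 * (‖r q‖ * S)) := mul_le_mul_of_nonneg_left
              (hb.trans (mul_le_mul_of_nonneg_left hc0 zero_le_two)) (norm_nonneg _)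
        _ = _ := by ring
    rw [Matrix.add_mul]
    refine (schatten_add_le _ _).trans ?_
    have f0 := hfullterm 0 (by norm_num)
    have f1 := hfullterm 1 (by norm_num)
    have f2 := hfullterm 2 (by norm_num)
    have g1 : 0 ≤ ‖r 1‖ ^ 2 * S := by positivity
    have g2 : 0 ≤ ‖r 2‖ ^ 2 * S := by positivity
    have g3 : 0 ≤ ‖r 3‖ ^ 2 * S := by positivity
    interval_cases q
    · exact absurd rfl h0
    · rw [Finset.sum_range_one]
      linarith
    · rw [Finset.sum_range_succ, Finset.sum_range_one, Matrix.add_mul]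
      have := schatten_add_le (kron (y 0 M) (r 0) * kron D (A1 α))
        (kron (y 1 M) (r 1) * kron D (A1 α))
      linarith
    · rw [Finset.sum_range_succ, Finset.sum_range_succ, Finset.sum_range_one, Matrix.add_mul,
        Matrix.add_mul]
      have := schatten_add_le (kron (y 0 M) (r 0) * kron D (A1 α))
        (kron (y 1 M) (r 1) * kron D (A1 α))
      have := schatten_add_le (kron (y 0 M) (r 0) * kron D (A1 α) +
        kron (y 1 M) (r 1) * kron D (A1 α)) (kron (y 2 M) (r 2) * kron D (A1 α))
      linarith

end helpers

/-- inductive estimate of Theorem 1,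
`c_{ν+1,♯} ≤ max{c_{ν,♯}‖r_0‖², ‖r_0‖² + 2 Σ_{q=1}^3 ‖r_q‖²}`. -/
theorem haar_inductive_basis_constant_sharp
    (α : ℝ) (hα0 : 0 < α) (hα : α ≤ 1 / 2)
    (r : ℕ → Matrix (Fin 2) (Fin 2) ℂ)
    (hr : ∀ j < 4, ∀ k < 4, rho1 α ((r j)ᴴ * r k) = if j = k then 1 else 0)
    (ν : ℕ) (hν : 1 ≤ ν) (c : ℝ) (hc : 0 ≤ c)
    (hbase : ∀ m < 4 ^ ν, ∀ a : ℕ → ℂ,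
      sharpNorm α (∑ j ∈ Finset.range (m + 1), a j • haar r ν j) ≤
        c * sharpNorm α (∑ j ∈ Finset.range (4 ^ ν), a j • haar r ν j)) :
    ∀ m < 4 ^ (ν + 1), ∀ a : ℕ → ℂ,
      sharpNorm α (∑ j ∈ Finset.range (m + 1), a j • haar r (ν + 1) j) ≤
        max (c * opNorm (r 0) ^ 2)
            (opNorm (r 0) ^ 2 + 2 * (opNorm (r 1) ^ 2 + opNorm (r 2) ^ 2 + opNorm (r 3) ^ 2)) *
          sharpNorm α (∑ j ∈ Finset.range (4 ^ (ν + 1)), a j • haar r (ν + 1) j) := by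
  obtain ⟨μ, rfl⟩ : ∃ μ, ν = μ + 1 := ⟨ν - 1, by omega⟩
  intro m hm a
  obtain ⟨d, hd⟩ := Amat_diag α (μ + 1)
  have hN : (4 : ℕ) ^ (μ + 1) = 2 ^ (μ + 1) * 2 ^ (μ + 1) := by
    rw [← mul_pow]
    norm_num
  have hN' : (4 : ℕ) ^ (μ + 1 + 1) = 2 ^ (μ + 1) * 2 ^ (μ + 1) * 4 := by
    rw [pow_succ, hN]
  have hMpos : 0 < 2 ^ (μ + 1) * 2 ^ (μ + 1) := by positivity
  have hb : ∀ m < 2 ^ (μ + 1) * 2 ^ (μ + 1), ∀ a : ℕ → ℂ,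
      schatten 1 ((∑ j ∈ Finset.range (m + 1), a j • haar r (μ + 1) j) * Matrix.diagonal d) ≤
        c * schatten 1 ((∑ j ∈ Finset.range (2 ^ (μ + 1) * 2 ^ (μ + 1)),
          a j • haar r (μ + 1) j) * Matrix.diagonal d) := by
    intro m hm a
    have := hbase m (by rw [hN]; exact hm) a
    rw [sharpNorm, sharpNorm, hd, hN] at this
    exact this
  rw [hN'] at hm ⊢
  have key := abstract_bound α hα0 hα d r hr c hc (haar r (μ + 1)) hb (haar r (μ + 1 + 1))
    (by
      intro k hk
      exact if_pos (by rw [hN, Nat.div_eq_of_lt hk]))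
    (by
      intro q hq hq0 k hk
      have e1 : (2 ^ (μ + 1) * 2 ^ (μ + 1) * q + k) / (2 ^ (μ + 1) * 2 ^ (μ + 1)) = q := by
        rw [Nat.mul_add_div hMpos, Nat.div_eq_of_lt hk, add_zero]
      have e2 : (2 ^ (μ + 1) * 2 ^ (μ + 1) * q + k) % (2 ^ (μ + 1) * 2 ^ (μ + 1)) = k := by
        rw [Nat.mul_add_mod, Nat.mod_eq_of_lt hk]
      refine (if_neg (by rw [hN, e1]; exact hq0)).trans ?_
      rw [hN, e1, e2, Nat.mod_eq_of_lt hq])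
    m hm a
  rw [← hd] at key
  exact key

end
end
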